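/- Let ℓ be a prime, let N ≥ 1 and k ≥ 0 be integers, let t be an integer, and let c be an integer with gcd(c, 6ℓ) = 1. For r ≥ 0 set S_r := ∑ B₂c(ℓʳN)(x)·x^k, the sum over all integers x with 0 ≤ x < ℓʳ·N and x ≡ t (mod N), and let L := (N^{k+1}/(c^k·(k+2)))·( c^{k+2}·B_{k+2}({t/N}) − B_{k+2}({c·t/N}) ) ∈ ℚ. Then for every r ≥ 0, the element S_r − L of ℚ_ℓ lies in ℓʳ·N·ℤ_ℓ (in particular L is an ℓ-adic integer and v_ℓ(S_r − L) ≥ r). -/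

import Mathlib

/-- The second Bernoulli polynomial `B₂(y) = y² − y + 1/6`. -/
noncomputable def B2 (y : ℚ) : ℚ := y ^ 2 - y + 1 / 6

/-- `B₂cM(x) = (M/2)·(c²·B₂({x/M}) − B₂({c·x/M}))`. -/
noncomputable def B2c (c M x : ℤ) : ℚ :=
  ((M : ℚ) / 2) * ((c : ℚ) ^ 2 * B2 (Int.fract ((x : ℚ) / (M : ℚ))) -
    B2 (Int.fract (((c * x : ℤ) : ℚ) / (M : ℚ))))

/-- `S_r = ∑_{0 ≤ x < ℓʳN, x ≡ t mod N} B₂c(ℓʳN)(x)·x^k`. -/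
noncomputable def S (ℓ N k : ℕ) (t c : ℤ) (r : ℕ) : ℚ :=
  ∑ x ∈ (Finset.Ico (0 : ℤ) ((ℓ : ℤ) ^ r * (N : ℤ))).filter
      (fun x => x % (N : ℤ) = t % (N : ℤ)),
    B2c c ((ℓ : ℤ) ^ r * (N : ℤ)) x * (x : ℚ) ^ k

/-- The limit `L = (N^{k+1}/(c^k(k+2)))·(c^{k+2}·B_{k+2}({t/N}) − B_{k+2}({ct/N}))`. -/
noncomputable def L (N k : ℕ) (t c : ℤ) : ℚ :=
  ((N : ℚ) ^ (k + 1) / ((c : ℚ) ^ k * ((k : ℚ) + 2))) *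
    ((c : ℚ) ^ (k + 2) * (Polynomial.bernoulli (k + 2)).eval (Int.fract ((t : ℚ) / (N : ℚ))) -
      (Polynomial.bernoulli (k + 2)).eval (Int.fract (((c * t : ℤ) : ℚ) / (N : ℚ))))

lemma sum_range_affine_of_periodic (p : ℕ) (hp : 0 < p) (c d : ℤ) (hc : IsCoprime c (p : ℤ))
    (f : ℤ → ℚ) (hf : Function.Periodic f (p : ℤ)) :
    ∑ j ∈ Finset.range p, f (c * j + d) = ∑ j ∈ Finset.range p, f j := by
  have : NeZero p := ⟨hp.ne'⟩
  have hval (i : ℤ) : f i = f ((i : ZMod p).val : ℤ) := by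
    rw [ZMod.val_intCast]
    have h := hf.int_mul (i / p) (i % p)
    rw [Int.cast_id, mul_comm, Int.emod_add_mul_ediv] at h
    exact h
  have hsum (g : ZMod p → ℚ) : ∑ j ∈ Finset.range p, g (j : ZMod p) = ∑ z, g z := by
    refine Finset.sum_bij' (fun j _ => (j : ZMod p)) (fun z _ => z.val) ?_ ?_ ?_ ?_ ?_
    · simp
    · intro z _; simpa using ZMod.val_lt z
    · intro j hj; exact ZMod.val_cast_of_lt (Finset.mem_range.mp hj)
    · intro z _; simp
    · simp
  obtain ⟨u, v, huv⟩ := hc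
  have hunit : (u : ZMod p) * c = 1 := by
    have := congrArg (Int.cast : ℤ → ZMod p) huv
    simpa using this
  have hbij : Function.Bijective (fun z : ZMod p => (c : ZMod p) * z + d) := by
    rw [← Finite.injective_iff_bijective]
    intro z w h
    have h' : (c : ZMod p) * z = c * w := add_right_cancel h
    calc z = u * c * z := by rw [hunit, one_mul]
      _ = u * c * w := by rw [mul_assoc, h', mul_assoc]
      _ = w := by rw [hunit, one_mul]
  calc ∑ j ∈ Finset.range p, f (c * j + d)
      = ∑ j ∈ Finset.range p, f (((c : ZMod p) * (j : ZMod p) + d).val : ℤ) :=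
        Finset.sum_congr rfl fun j _ => by rw [hval]; push_cast; rfl
    _ = ∑ z : ZMod p, f (((c : ZMod p) * z + d).val : ℤ) :=
        hsum (fun z => f (((c : ZMod p) * z + d).val : ℤ))
    _ = ∑ z : ZMod p, f (z.val : ℤ) :=
        hbij.sum_comp (fun z : ZMod p => f (z.val : ℤ))
    _ = ∑ j ∈ Finset.range p, f ((j : ZMod p).val : ℤ) :=
        (hsum (fun z => f (z.val : ℤ))).symm
    _ = ∑ j ∈ Finset.range p, f j :=
        Finset.sum_congr rfl fun j _ => by rw [hval j]; simp

lemma sum_B2_range (p : ℕ) (hp : 0 < p) (u : ℚ) :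
    (p : ℚ) * ∑ j ∈ Finset.range p, B2 ((u + j) / p) = B2 u := by
  have hp' : (p : ℚ) ≠ 0 := by exact_mod_cast hp.ne'
  have key (m : ℕ) : ∑ j ∈ Finset.range m, B2 ((u + j) / p) =
      (m * u ^ 2 + u * m * (m - 1) + (m - 1) * m * (2 * m - 1) / 6) / (p : ℚ) ^ 2
        - (m * u + m * (m - 1) / 2) / p + m / 6 := by
    induction m with
    | zero => simp
    | succ m ih =>
      rw [Finset.sum_range_succ, ih]
      unfold B2
      push_cast
      field_simp
      ring
  rw [key]
  unfold B2
  field_simp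
  ring

lemma sum_B2_fract (p : ℕ) (hp : 0 < p) (c : ℤ) (hc : IsCoprime c (p : ℤ)) (v : ℚ) :
    (p : ℚ) * ∑ j ∈ Finset.range p, B2 (Int.fract ((v + c * j) / p)) = B2 (Int.fract v) := by
  have hp' : (0 : ℚ) < p := by exact_mod_cast hp
  have hper : Function.Periodic
      (fun i : ℤ => B2 (Int.fract ((Int.fract v + i) / (p : ℚ)))) (p : ℤ) := by
    intro i
    have : (Int.fract v + ((i + p : ℤ) : ℚ)) / (p : ℚ) = (Int.fract v + i) / p + 1 := by
      push_cast
      field_simp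
      ring
    simp only [this, Int.fract_add_one]
  have h := sum_range_affine_of_periodic p hp c ⌊v⌋ hc _ hper
  rw [← sum_B2_range p hp (Int.fract v)]
  congr 1
  calc _ = ∑ j ∈ Finset.range p,
        B2 (Int.fract ((Int.fract v + ((c * j + ⌊v⌋ : ℤ) : ℚ)) / (p : ℚ))) := by
        refine Finset.sum_congr rfl fun j _ => ?_
        congr 3
        push_cast
        rw [← Int.self_sub_floor]
        ring
    _ = _ := h
    _ = _ := by
        refine Finset.sum_congr rfl fun j hj => ?_
        have hj' : (j : ℚ) + 1 ≤ p := by exact_mod_cast Finset.mem_range.mp hj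
        have h0 := Int.fract_nonneg v
        have h1 := Int.fract_lt_one v
        congr 1
        rw [Int.cast_natCast, Int.fract_eq_self]
        exact ⟨by positivity, by rw [div_lt_one hp']; linarith⟩

/-- Distribution relation. -/
lemma sum_B2c (p : ℕ) (hp : 0 < p) (c M x : ℤ) (hM : 0 < M) (hc : IsCoprime c (p : ℤ)) :
    ∑ j ∈ Finset.range p, B2c c (p * M) (x + j * M) = B2c c M x := by
  have hM' : (M : ℚ) ≠ 0 := by exact_mod_cast hM.ne'
  have hp' : (p : ℚ) ≠ 0 := by exact_mod_cast hp.ne'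
  have h1 := sum_B2_fract p hp 1 isCoprime_one_left ((x : ℚ) / M)
  have h2 := sum_B2_fract p hp c hc (((c * x : ℤ) : ℚ) / M)
  unfold B2c
  rw [← h1, ← h2, ← Finset.mul_sum, Finset.sum_sub_distrib, ← Finset.mul_sum]
  have e1 (j : ℕ) : ((x + j * M : ℤ) : ℚ) / ((p * M : ℤ) : ℚ) = (x / M + (1 : ℤ) * j) / p := by
    push_cast
    field_simp
  have e2 (j : ℕ) : ((c * (x + j * M) : ℤ) : ℚ) / ((p * M : ℤ) : ℚ) =
      (((c * x : ℤ) : ℚ) / M + c * j) / p := by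
    push_cast
    field_simp
  simp only [e1, e2]
  push_cast
  ring

lemma B2c_add_mul (c M x i : ℤ) (hM : 0 < M) : B2c c M (x + i * M) = B2c c M x := by
  have hM' : (M : ℚ) ≠ 0 := by exact_mod_cast hM.ne'
  have e1 : ((x + i * M : ℤ) : ℚ) / M = x / M + (i : ℤ) := by push_cast; field_simp
  have e2 : ((c * (x + i * M) : ℤ) : ℚ) / M = ((c * x : ℤ) : ℚ) / M + (c * i : ℤ) := by
    push_cast; field_simp
  unfold B2c
  rw [e1, e2, Int.fract_add_intCast, Int.fract_add_intCast]

lemma B2c_eq (c M x : ℤ) (hx : 0 ≤ x) (hxM : x < M) :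
    B2c c M x = c * x * (c * x / M : ℤ) - c * (c - 1) / 2 * x
      - M * ((c * x / M : ℤ) * ((c * x / M : ℤ) + 1)) / 2 + M * (c ^ 2 - 1) / 12 := by
  have hM' : (0 : ℚ) < M := by exact_mod_cast hx.trans_lt hxM
  have hx' : (0 : ℚ) ≤ x := by exact_mod_cast hx
  have hxM' : (x : ℚ) < M := by exact_mod_cast hxM
  have e1 : Int.fract ((x : ℚ) / M) = x / M :=
    Int.fract_eq_self.mpr ⟨by positivity, by rwa [div_lt_one hM']⟩
  have e2 : Int.fract (((c * x : ℤ) : ℚ) / M) = (c * x - M * (c * x / M : ℤ)) / M := by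
    have hfloor : ⌊((c * x : ℤ) : ℚ) / M⌋ = c * x / M := by
      lift M to ℕ using (hx.trans_lt hxM).le
      exact Rat.floor_intCast_div_natCast _ _
    rw [← Int.self_sub_floor, hfloor]
    push_cast
    field_simp
  unfold B2c B2
  rw [e1, e2]
  field_simp
  ring

lemma exists_int_B2c (c M x : ℤ) (hM : 0 < M) (hc : IsCoprime c 6) :
    ∃ z : ℤ, B2c c M x = z := by
  have h12 : (12 : ℤ) ∣ c ^ 2 - 1 := by
    obtain ⟨u, v, huv⟩ := hc
    have h2 : c % 2 ≠ 0 := by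
      intro h
      obtain ⟨d, rfl⟩ := Int.dvd_of_emod_eq_zero h
      have : 2 * (u * d + 3 * v) = 1 := by linarith
      omega
    have h3 : c % 3 ≠ 0 := by
      intro h
      obtain ⟨d, rfl⟩ := Int.dvd_of_emod_eq_zero h
      have : 3 * (u * d + 2 * v) = 1 := by linarith
      omega
    have hcases : c % 12 = 1 ∨ c % 12 = 5 ∨ c % 12 = 7 ∨ c % 12 = 11 := by omega
    rw [← Int.emod_add_mul_ediv c 12]
    generalize c / 12 = w
    rcases hcases with h | h | h | h <;> rw [h]
    · exact ⟨12 * w ^ 2 + 2 * w, by ring⟩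
    · exact ⟨12 * w ^ 2 + 10 * w + 2, by ring⟩
    · exact ⟨12 * w ^ 2 + 14 * w + 4, by ring⟩
    · exact ⟨12 * w ^ 2 + 22 * w + 10, by ring⟩
  obtain ⟨e, he⟩ := h12
  obtain ⟨s, hs⟩ := even_iff_two_dvd.mp (Int.even_mul_pred_self c)
  have hxm : x = x % M + x / M * M := (Int.emod_add_ediv_mul x M).symm
  rw [hxm, B2c_add_mul _ _ _ _ hM,
    B2c_eq c M _ (Int.emod_nonneg x hM.ne') (Int.emod_lt_of_pos x hM)]
  set y := x % M
  set q := c * y / M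
  obtain ⟨w, hw⟩ := even_iff_two_dvd.mp (Int.even_mul_succ_self q)
  refine ⟨c * y * q - s * y - M * w + M * e, ?_⟩
  have he' : (c : ℚ) ^ 2 - 1 = 12 * e := by exact_mod_cast he
  have hs' : (c : ℚ) * (c - 1) = 2 * s := by exact_mod_cast hs
  have hw' : (q : ℚ) * (q + 1) = 2 * w := by exact_mod_cast hw
  rw [he', hs', hw']
  push_cast
  ring

lemma S_eq_sum_range (ℓ N k : ℕ) (hN : 1 ≤ N) (t c : ℤ) (r : ℕ) :
    S ℓ N k t c r = ∑ j ∈ Finset.range (ℓ ^ r),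
      B2c c ((ℓ : ℤ) ^ r * N) (t % N + j * N) * ((t % N + j * N : ℤ) : ℚ) ^ k := by
  have hN' : (0 : ℤ) < N := by exact_mod_cast hN
  have h0 := Int.emod_nonneg t hN'.ne'
  have h1 := Int.emod_lt_of_pos t hN'
  symm
  unfold S
  refine Finset.sum_bij (fun j _ => t % N + j * N) ?_ ?_ ?_ (fun _ _ => rfl)
  · intro j hj
    have hj' : (j : ℤ) + 1 ≤ (ℓ : ℤ) ^ r := by exact_mod_cast Finset.mem_range.mp hj
    simp only [Finset.mem_filter, Finset.mem_Ico]
    refine ⟨⟨by positivity, by nlinarith⟩, by simp⟩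
  · intro i _ j _ h
    have h' : (i : ℤ) * N = j * N := add_left_cancel h
    exact_mod_cast mul_right_cancel₀ hN'.ne' h'
  · intro x hx
    simp only [Finset.mem_filter, Finset.mem_Ico] at hx
    obtain ⟨⟨hx0, hx1⟩, hxt⟩ := hx
    have hq : 0 ≤ x / N := Int.ediv_nonneg hx0 hN'.le
    refine ⟨(x / N).toNat, ?_, ?_⟩
    · rw [Finset.mem_range, Int.toNat_lt hq]
      push_cast
      exact Int.ediv_lt_of_lt_mul hN' hx1
    · rw [Int.toNat_of_nonneg hq, ← hxt]
      exact Int.emod_add_ediv_mul x N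

lemma sum_range_mul_eq_sum_sum (m p : ℕ) (f : ℕ → ℚ) :
    ∑ j ∈ Finset.range (m * p), f j =
      ∑ i ∈ Finset.range m, ∑ j ∈ Finset.range p, f (i + m * j) := by
  rw [Finset.sum_comm]
  induction p with
  | zero => simp
  | succ p ih =>
    rw [Nat.mul_succ, Finset.sum_range_add, ih, Finset.sum_range_succ]
    simp only [add_comm]

lemma exists_int_sum_B2c_sub (m p N k : ℕ) (hm : 0 < m) (hp : 0 < p) (hN : 0 < N) (a c : ℤ)
    (hc : IsCoprime c 6) (hcp : IsCoprime c (p : ℤ)) :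
    ∃ z : ℤ, ∑ j ∈ Finset.range (m * p),
        B2c c (p * (m * N)) (a + j * N) * ((a + j * N : ℤ) : ℚ) ^ k -
      ∑ i ∈ Finset.range m, B2c c (m * N) (a + i * N) * ((a + i * N : ℤ) : ℚ) ^ k =
        (m * N : ℚ) * z := by
  have hM : (0 : ℤ) < m * N := by positivity
  have hpM : (0 : ℤ) < p * (m * N) := by positivity
  have key (i j : ℕ) : ∃ z : ℤ,
      B2c c (p * (m * N)) (a + (i + m * j : ℕ) * N) * ((a + (i + m * j : ℕ) * N : ℤ) : ℚ) ^ k =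
      B2c c (p * (m * N)) ((a + i * N) + j * (m * N)) * ((a + i * N : ℤ) : ℚ) ^ k
        + (m * N : ℚ) * z := by
    have e : a + (i + m * j : ℕ) * (N : ℤ) = (a + i * N) + j * (m * N) := by push_cast; ring
    rw [e]
    obtain ⟨b, hb⟩ := exists_int_B2c c (p * (m * N)) ((a + i * N) + j * (m * N)) hpM hc
    have hd : (m * N : ℤ) ∣ (a + i * N + j * (m * N)) ^ k - (a + i * N) ^ k :=
      (Dvd.intro_left (j : ℤ) (by ring)).trans (sub_dvd_pow_sub_pow _ _ k)
    obtain ⟨w, hw⟩ := hd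
    refine ⟨b * w, ?_⟩
    have hw' : ((a + i * N + j * (m * N) : ℤ) : ℚ) ^ k - ((a + i * N : ℤ) : ℚ) ^ k
        = (m * N : ℚ) * w := by exact_mod_cast hw
    rw [hb]
    push_cast at hw' ⊢
    linear_combination (b : ℚ) * hw'
  choose z hz using key
  refine ⟨∑ i ∈ Finset.range m, ∑ j ∈ Finset.range p, z i j, ?_⟩
  rw [sum_range_mul_eq_sum_sum]
  simp only [hz, Finset.sum_add_distrib, ← Finset.sum_mul, sum_B2c p hp c (m * N) _ hM hcp]
  push_cast
  simp only [Finset.mul_sum]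
  ring

lemma sum_emod_pow (m N n : ℕ) (hm : 0 < m) (hN : 0 < N) (t c : ℤ)
    (hc : IsCoprime c (m : ℤ)) :
    ∑ j ∈ Finset.range m, ((c * (t % N + j * N) % (m * N) : ℤ) : ℚ) ^ n =
      ∑ j ∈ Finset.range m, ((c * t % N + j * N : ℤ) : ℚ) ^ n := by
  have hN' : (0 : ℤ) < N := by exact_mod_cast hN
  set b := c * t % N
  obtain ⟨d, hd⟩ : ∃ d, c * (t % N) = b + N * d := by
    refine ⟨c * t / N - c * (t / N), ?_⟩
    have h1 := Int.emod_add_mul_ediv (c * t) N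
    have h2 := Int.emod_add_mul_ediv t N
    linear_combination -h1 + c * h2
  have hper : Function.Periodic
      (fun i : ℤ => ((((b + i * N) % (m * N) : ℤ) : ℚ)) ^ n) (m : ℤ) := by
    intro i
    have : b + (i + m) * (N : ℤ) = b + i * N + m * N := by ring
    simp only [this, Int.add_emod_right]
  have h := sum_range_affine_of_periodic m hm c d hc _ hper
  calc _ = ∑ j ∈ Finset.range m, (((b + (c * j + d) * N) % (m * N) : ℤ) : ℚ) ^ n := by
        refine Finset.sum_congr rfl fun j _ => ?_
        congr 3
        linear_combination hd
    _ = _ := h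
    _ = _ := by
        refine Finset.sum_congr rfl fun j hj => ?_
        have hj' : (j : ℤ) + 1 ≤ m := by exact_mod_cast Finset.mem_range.mp hj
        have h0 := Int.emod_nonneg (c * t) hN'.ne'
        have h1 := Int.emod_lt_of_pos (c * t) hN'
        rw [Int.emod_eq_of_lt (by positivity) (by nlinarith)]

lemma exists_int_mul_pow_mul_B2c (c M x : ℤ) (k : ℕ) (hx : 0 ≤ x) (hxM : x < M) :
    ∃ z : ℤ, (c : ℚ) ^ k * (B2c c M x * (x : ℚ) ^ k) =
      ((c : ℚ) ^ (k + 2) * (x : ℚ) ^ (k + 2) - ((c * x % M : ℤ) : ℚ) ^ (k + 2)) / ((k + 2) * M)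
        - (c : ℚ) ^ k * (c * (c - 1) / 2) * (x : ℚ) ^ (k + 1)
        + M * z / (12 * (k + 2)) := by
  have hM : (M : ℚ) ≠ 0 := by exact_mod_cast (hx.trans_lt hxM).ne'
  rw [B2c_eq c M x hx hxM]
  set q := c * x / M
  have hy : c * x % M = c * x + -(M * q) := by
    linear_combination Int.emod_add_mul_ediv (c * x) M
  obtain ⟨w, hw⟩ := Polynomial.powAddExpansion (c * x) (-(M * q)) (k + 2)
  rw [← hy] at hw
  have hw' : ((c * x % M : ℤ) : ℚ) ^ (k + 2) = (c : ℚ) ^ (k + 2) * (x : ℚ) ^ (k + 2)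
      + (k + 2) * ((c : ℚ) ^ (k + 1) * (x : ℚ) ^ (k + 1)) * (-(M * q))
      + w * (M * q) ^ 2 := by
    have := congrArg (Int.cast : ℤ → ℚ) hw
    push_cast at this
    rw [this]
    simp only [mul_pow, neg_sq]
  rw [hw']
  refine ⟨12 * w * q ^ 2 + (k + 2) * c ^ k * x ^ k * (-6 * (q * (q + 1)) + (c ^ 2 - 1)), ?_⟩
  have hk : (k : ℚ) + 2 ≠ 0 := by positivity
  push_cast
  field_simp
  ring

lemma exists_int_sum_B2c_eq (m N k : ℕ) (hm : 0 < m) (hN : 0 < N) (t c : ℤ)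
    (hc : IsCoprime c (m : ℤ)) :
    ∃ z : ℤ, (c : ℚ) ^ k * ∑ j ∈ Finset.range m,
        B2c c (m * N) (t % N + j * N) * ((t % N + j * N : ℤ) : ℚ) ^ k =
      ((c : ℚ) ^ (k + 2) * ∑ j ∈ Finset.range m, ((t % N + j * N : ℤ) : ℚ) ^ (k + 2)
        - ∑ j ∈ Finset.range m, ((c * t % N + j * N : ℤ) : ℚ) ^ (k + 2)) / ((k + 2) * (m * N))
        - (c : ℚ) ^ k * (c * (c - 1) / 2) *
            ∑ j ∈ Finset.range m, ((t % N + j * N : ℤ) : ℚ) ^ (k + 1)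
        + (m * N) * z / (12 * (k + 2)) := by
  have hN' : (0 : ℤ) < N := by exact_mod_cast hN
  have h0 := Int.emod_nonneg t hN'.ne'
  have h1 := Int.emod_lt_of_pos t hN'
  have key (j : ℕ) (hj : j ∈ Finset.range m) :=
    exists_int_mul_pow_mul_B2c c (m * N) (t % N + j * N) k (by positivity) (by
      have hj' : (j : ℤ) + 1 ≤ m := by exact_mod_cast Finset.mem_range.mp hj
      nlinarith)
  choose! z hz using key
  refine ⟨∑ j ∈ Finset.range m, z j, ?_⟩
  rw [← sum_emod_pow m N (k + 2) hm hN t c hc, Finset.mul_sum, Finset.sum_congr rfl hz]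
  simp only [Finset.sum_add_distrib, Finset.sum_sub_distrib, ← Finset.sum_div, ← Finset.mul_sum]
  push_cast
  rfl

lemma sum_range_pow_eq_bernoulli_eval_sub (m n : ℕ) (y : ℚ) :
    (n + 1 : ℚ) * ∑ j ∈ Finset.range m, (y + j) ^ n =
      (Polynomial.bernoulli (n + 1)).eval (y + m) - (Polynomial.bernoulli (n + 1)).eval y := by
  induction m with
  | zero => simp
  | succ m ih =>
    rw [Finset.sum_range_succ, mul_add, ih]
    have h := Polynomial.bernoulli_eval_one_add (n + 1) (y + m)
    rw [show y + ((m + 1 : ℕ) : ℚ) = 1 + (y + m) by push_cast; ring, h]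
    push_cast
    ring

open Filter Topology in
lemma tendsto_sum_pow_div (ℓ : ℕ) [Fact ℓ.Prime] (N n : ℕ) (hN : 0 < N) (a : ℤ) :
    Tendsto (fun R : ℕ =>
      ((∑ j ∈ Finset.range (ℓ ^ R), ((a + j * N : ℤ) : ℚ) ^ n : ℚ) : ℚ_[ℓ]) / (ℓ : ℚ_[ℓ]) ^ R)
      atTop (𝓝 (((N : ℚ) ^ n * (Polynomial.bernoulli n).eval ((a : ℚ) / N) : ℚ) : ℚ_[ℓ])) := by
  have hN' : (N : ℚ) ≠ 0 := by exact_mod_cast hN.ne'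
  have hn : (n : ℚ_[ℓ]) + 1 ≠ 0 := by exact_mod_cast n.succ_ne_zero
  have hℓ : (ℓ : ℚ_[ℓ]) ≠ 0 := by exact_mod_cast (Fact.out : ℓ.Prime).ne_zero
  set B := (Polynomial.bernoulli (n + 1)).map (algebraMap ℚ ℚ_[ℓ]) with hB
  have heval (y : ℚ) : B.eval (y : ℚ_[ℓ]) =
      (((Polynomial.bernoulli (n + 1)).eval y : ℚ) : ℚ_[ℓ]) := by
    have := Polynomial.eval_map_apply (algebraMap ℚ ℚ_[ℓ]) y (p := Polynomial.bernoulli (n + 1))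
    rw [hB]
    simpa using this
  have hpow : Tendsto (fun R : ℕ => (ℓ : ℚ_[ℓ]) ^ R) atTop (𝓝[≠] 0) :=
    tendsto_nhdsWithin_iff.mpr
      ⟨tendsto_pow_atTop_nhds_zero_of_norm_lt_one Padic.norm_p_lt_one,
        Eventually.of_forall fun R => pow_ne_zero R hℓ⟩
  have hslope := (hasDerivAt_iff_tendsto_slope_zero.mp
    (B.hasDerivAt (((a : ℚ) / N : ℚ) : ℚ_[ℓ]))).comp hpow
  have hder : B.derivative.eval (((a : ℚ) / N : ℚ) : ℚ_[ℓ]) =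
      (n + 1) * (((Polynomial.bernoulli n).eval ((a : ℚ) / N) : ℚ) : ℚ_[ℓ]) := by
    rw [hB, Polynomial.derivative_map, Polynomial.derivative_bernoulli_add_one]
    have := Polynomial.eval_map_apply (algebraMap ℚ ℚ_[ℓ]) ((a : ℚ) / N)
      (p := ((n : Polynomial ℚ) + 1) * Polynomial.bernoulli n)
    simpa using this
  rw [hder] at hslope
  have hlim := hslope.const_mul ((N : ℚ_[ℓ]) ^ n / (n + 1))
  convert hlim using 2
  · rename_i R
    have hsum : ∑ j ∈ Finset.range (ℓ ^ R), ((a + j * N : ℤ) : ℚ) ^ n =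
        (N : ℚ) ^ n * ∑ j ∈ Finset.range (ℓ ^ R), ((a : ℚ) / N + j) ^ n := by
      rw [Finset.mul_sum]
      refine Finset.sum_congr rfl fun j _ => ?_
      rw [← mul_pow]
      congr 1
      push_cast
      field_simp
    have hS := congrArg (Rat.cast : ℚ → ℚ_[ℓ])
      (sum_range_pow_eq_bernoulli_eval_sub (ℓ ^ R) n ((a : ℚ) / N))
    rw [Rat.cast_sub, ← heval, ← heval, Rat.cast_mul] at hS
    rw [hsum]
    simp only [Function.comp_apply, smul_eq_mul]
    have e : ((((a : ℚ) / N + (ℓ ^ R : ℕ) : ℚ)) : ℚ_[ℓ]) =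
        (((a : ℚ) / N : ℚ) : ℚ_[ℓ]) + (ℓ : ℚ_[ℓ]) ^ R := by push_cast; rfl
    rw [e] at hS
    rw [← hS, Rat.cast_mul]
    generalize ((∑ j ∈ Finset.range (ℓ ^ R), ((a : ℚ) / N + j) ^ n : ℚ) : ℚ_[ℓ]) = s
    push_cast
    field_simp
  · push_cast
    field_simp

open Filter Topology in
lemma tendsto_S (ℓ : ℕ) [Fact ℓ.Prime] (N k : ℕ) (hN : 1 ≤ N) (t c : ℤ) (hc0 : c ≠ 0)
    (hc : IsCoprime c (ℓ : ℤ)) :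
    Tendsto (fun R : ℕ => ((S ℓ N k t c R : ℚ) : ℚ_[ℓ])) atTop
      (𝓝 ((L N k t c : ℚ) : ℚ_[ℓ])) := by
  have hℓ' : 0 < ℓ := (Fact.out : ℓ.Prime).pos
  have hℓ : (ℓ : ℚ_[ℓ]) ≠ 0 := by exact_mod_cast hℓ'.ne'
  have hNp : (N : ℚ_[ℓ]) ≠ 0 := by exact_mod_cast (Nat.one_le_iff_ne_zero.mp hN)
  have hcp : (c : ℚ_[ℓ]) ≠ 0 := by exact_mod_cast hc0
  have hk : (k : ℚ_[ℓ]) + 2 ≠ 0 := by exact_mod_cast (k + 1).succ_ne_zero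
  have hkey (R : ℕ) := exists_int_sum_B2c_eq (ℓ ^ R) N k (pow_pos hℓ' R) hN t c
    (by push_cast; exact hc.pow_right)
  choose z hz using hkey
  have hpow : Tendsto (fun R : ℕ => (ℓ : ℚ_[ℓ]) ^ R) atTop (𝓝 0) :=
    tendsto_pow_atTop_nhds_zero_of_norm_lt_one Padic.norm_p_lt_one
  have hzlim : Tendsto (fun R : ℕ => (ℓ : ℚ_[ℓ]) ^ R * (z R : ℚ_[ℓ])) atTop (𝓝 0) := by
    refine squeeze_zero_norm (fun R => ?_) (tendsto_zero_iff_norm_tendsto_zero.mp hpow)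
    rw [norm_mul]
    exact mul_le_of_le_one_right (norm_nonneg _) (Padic.norm_int_le_one _)
  have h1 := tendsto_sum_pow_div ℓ N (k + 2) hN (t % N)
  have h2 := tendsto_sum_pow_div ℓ N (k + 2) hN (c * t % N)
  have h3 := hpow.mul (tendsto_sum_pow_div ℓ N (k + 1) hN (t % N))
  have hlim := ((((h1.const_mul ((c : ℚ_[ℓ]) ^ (k + 2))).sub h2).div_const ((k + 2) * N)).sub
    (h3.const_mul ((c : ℚ_[ℓ]) ^ k * (c * (c - 1) / 2)))).add
    (hzlim.const_mul ((N : ℚ_[ℓ]) / (12 * (k + 2)))) |>.const_mul (((c : ℚ_[ℓ]) ^ k)⁻¹)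
  convert hlim using 2
  · rename_i R
    have hzR := congrArg (Rat.cast : ℚ → ℚ_[ℓ]) (hz R)
    push_cast at hzR
    rw [S_eq_sum_range ℓ N k hN]
    push_cast
    rw [eq_inv_mul_iff_mul_eq₀ (pow_ne_zero k hcp), hzR]
    generalize (∑ x ∈ Finset.range (ℓ ^ R), (_ : ℚ_[ℓ]) ^ (k + 1)) = s₁
    generalize (∑ x ∈ Finset.range (ℓ ^ R), (((t % N : ℤ) : ℚ_[ℓ]) + _) ^ (k + 2)) = s₂
    generalize (∑ x ∈ Finset.range (ℓ ^ R), (_ : ℚ_[ℓ]) ^ (k + 2)) = s₃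
    field_simp
  · unfold L
    rw [Int.fract_div_intCast_eq_div_intCast_mod, Int.fract_div_intCast_eq_div_intCast_mod]
    push_cast
    field_simp
    ring

/-- Finite-level congruence: `S_r − L ∈ ℓʳ·N·ℤ_ℓ` inside `ℚ_ℓ`. -/
theorem stmt4 (ℓ : ℕ) [Fact ℓ.Prime] (N : ℕ) (hN : 1 ≤ N) (k : ℕ) (t c : ℤ)
    (hc : Int.gcd c (6 * ℓ) = 1) (r : ℕ) :
    ∃ z : ℤ_[ℓ], ((S ℓ N k t c r - L N k t c : ℚ) : ℚ_[ℓ]) =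
      ((ℓ : ℚ_[ℓ]) ^ r * (N : ℚ_[ℓ])) * (z : ℚ_[ℓ]) := by
  have hℓ' : 0 < ℓ := (Fact.out : ℓ.Prime).pos
  have hcop : IsCoprime c (6 * ℓ) := Int.isCoprime_iff_gcd_eq_one.mpr hc
  have hc6 : IsCoprime c 6 := hcop.of_mul_right_left
  have hcℓ : IsCoprime c (ℓ : ℤ) := hcop.of_mul_right_right
  have hc0 : c ≠ 0 := by
    rintro rfl
    obtain ⟨u, v, huv⟩ := hc6
    omega
  have hM : (ℓ : ℚ_[ℓ]) ^ r * (N : ℚ_[ℓ]) ≠ 0 := by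
    have : ℓ ^ r * N ≠ 0 := (Nat.mul_pos (pow_pos hℓ' r) hN).ne'
    exact_mod_cast this
  have hlim := (((tendsto_S ℓ N k hN t c hc0 hcℓ).const_sub
    ((S ℓ N k t c r : ℚ) : ℚ_[ℓ])).div_const ((ℓ : ℚ_[ℓ]) ^ r * (N : ℚ_[ℓ]))).norm
  have hle := le_of_tendsto hlim (b := 1) (by
    filter_upwards [Filter.eventually_ge_atTop r] with R hR
    obtain ⟨s, rfl⟩ := Nat.exists_eq_add_of_le hR
    obtain ⟨z, hz⟩ := exists_int_sum_B2c_sub (ℓ ^ r) (ℓ ^ s) N k (pow_pos hℓ' r)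
      (pow_pos hℓ' s) hN (t % N) c hc6 (by push_cast; exact hcℓ.pow_right)
    have hS : S ℓ N k t c (r + s) - S ℓ N k t c r = ((ℓ : ℚ) ^ r * N) * z := by
      rw [S_eq_sum_range ℓ N k hN, S_eq_sum_range ℓ N k hN, pow_add ℓ]
      push_cast at hz
      rw [← hz, pow_add, mul_comm ((ℓ : ℤ) ^ r), mul_assoc]
      push_cast
      rfl
    have hS' := congrArg (Rat.cast : ℚ → ℚ_[ℓ]) hS
    push_cast at hS'
    rw [← neg_sub, hS', neg_div, mul_div_cancel_left₀ _ hM, norm_neg]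
    exact Padic.norm_int_le_one z)
  refine ⟨⟨_, hle⟩, ?_⟩
  rw [mul_div_cancel₀ _ hM]
  push_cast
  rfl
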